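/- arXiv:1904.10921 — 2 statements merged into one kernel-verified Lean document; each statement's English description precedes it below -/
import Mathlib

section
/- Let b : ℝ → ℝ be the step function b(w) = 1 if w > 0 and b(w) = 0 otherwise, let g : ℝ → ℝ be differentiable at a point w₀ with w₀ ≠ 0, and let M be a positive integer such that M·w₀ is not an integer. Then the trainable gate TG^(M)(·; g) := b + s^(M)·g is differentiable at w₀ with derivative g(w₀) + s^(M)(w₀)·g′(w₀). -/
/-- The gradient shaping function `s^(M)(w) = (M·w − ⌊M·w⌋)/M`. -/
noncomputable def gradShape (M : ℕ) (w : ℝ) : ℝ :=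
  ((M : ℝ) * w - ⌊(M : ℝ) * w⌋) / M

/-- The step gate: `b(w) = 1` if `w > 0`, and `0` otherwise. -/
noncomputable def stepGate (w : ℝ) : ℝ := if w > 0 then 1 else 0

/-- The trainable gate `TG^(M)(w; g) = b(w) + s^(M)(w)·g(w)`. -/
noncomputable def trainableGate (M : ℕ) (b g : ℝ → ℝ) (w : ℝ) : ℝ :=
  b w + gradShape M w * g w

theorem stepGate_hasDerivAt {w₀ : ℝ} (hw₀ : w₀ ≠ 0) : HasDerivAt stepGate 0 w₀ := by
  rcases lt_or_gt_of_ne hw₀ with h | h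
  · refine (hasDerivAt_const w₀ (0 : ℝ)).congr_of_eventuallyEq ?_
    filter_upwards [Iio_mem_nhds h] with w hw
    exact if_neg (not_lt.mpr (le_of_lt hw))
  · refine (hasDerivAt_const w₀ (1 : ℝ)).congr_of_eventuallyEq ?_
    filter_upwards [Ioi_mem_nhds h] with w hw
    exact if_pos hw

theorem gradShape_hasDerivAt {M : ℕ} (hM : 0 < M) {w₀ : ℝ}
    (hMw : ¬ ∃ k : ℤ, (M : ℝ) * w₀ = k) : HasDerivAt (gradShape M) 1 w₀ := by
  have hM' : (M : ℝ) ≠ 0 := Nat.cast_ne_zero.mpr hM.ne'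
  have hlin : HasDerivAt (fun w : ℝ => ((M : ℝ) * w - ⌊(M : ℝ) * w₀⌋) / M) 1 w₀ := by
    simpa [hM'] using
      (((hasDerivAt_id w₀).const_mul (M : ℝ)).sub_const (⌊(M : ℝ) * w₀⌋ : ℝ)).div_const (M : ℝ)
  refine hlin.congr_of_eventuallyEq ?_
  have hlt : (⌊(M : ℝ) * w₀⌋ : ℝ) < M * w₀ :=
    lt_of_le_of_ne (Int.floor_le _) fun h => hMw ⟨_, h.symm⟩
  have hcont : ContinuousAt (fun w : ℝ => (M : ℝ) * w) w₀ := by fun_prop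
  filter_upwards [hcont.eventually (Ioo_mem_nhds hlt (Int.lt_floor_add_one _))] with w hw
  have hfloor : ⌊(M : ℝ) * w⌋ = ⌊(M : ℝ) * w₀⌋ := Int.floor_eq_iff.mpr ⟨hw.1.le, hw.2⟩
  simp only [gradShape, hfloor]

theorem trainableGate_hasDerivAt (g : ℝ → ℝ) (g' w₀ : ℝ)
    (hg : HasDerivAt g g' w₀) (hw₀ : w₀ ≠ 0) (M : ℕ) (hM : 0 < M)
    (hMw : ¬ ∃ k : ℤ, (M : ℝ) * w₀ = k) :
    HasDerivAt (trainableGate M stepGate g)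
      (g w₀ + gradShape M w₀ * g') w₀ := by
  have h := (stepGate_hasDerivAt hw₀).add ((gradShape_hasDerivAt hM hMw).mul hg)
  rw [zero_add, one_mul] at h
  exact h
end

section
/- Let b : ℝ → ℝ be the step function b(w) = 1 if w > 0 and b(w) = 0 otherwise, and let g : ℝ → ℝ be differentiable with both |g| and |g′| bounded by a constant C. Then for every positive integer M and every real w₀ ≠ 0 with M·w₀ not an integer, the derivative of the trainable gate TG^(M)(·; g) := b + s^(M)·g at w₀ satisfies |d/dw TG^(M)(w; g)|_{w = w₀} − g(w₀)| ≤ C/M. Consequently, as M → ∞ the derivative of TG^(M)(·; g) converges to g uniformly on the set of points where it is defined. -/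
lemma hasDerivAt_stepGate {w₀ : ℝ} (hw : w₀ ≠ 0) : HasDerivAt stepGate 0 w₀ := by
  rcases hw.lt_or_gt with h | h
  · refine (hasDerivAt_const w₀ (0 : ℝ)).congr_of_eventuallyEq ?_
    filter_upwards [Iio_mem_nhds h] with w hw
    exact if_neg (not_lt.2 (le_of_lt hw))
  · refine (hasDerivAt_const w₀ (1 : ℝ)).congr_of_eventuallyEq ?_
    filter_upwards [Ioi_mem_nhds h] with w hw
    exact if_pos hw

/-- Away from `M⁻¹ℤ`, the gradient shaping function has slope one. -/
lemma hasDerivAt_gradShape {M : ℕ} (hM : 0 < M) {w₀ : ℝ}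
    (hw : ¬ ∃ k : ℤ, (M : ℝ) * w₀ = k) : HasDerivAt (gradShape M) 1 w₀ := by
  have hM' : (M : ℝ) ≠ 0 := by positivity
  have hlin : HasDerivAt
      (fun w : ℝ => ((M : ℝ) * w - (⌊(M : ℝ) * w₀⌋ : ℝ)) / M) 1 w₀ := by
    have h := (((hasDerivAt_id w₀).const_mul (M : ℝ)).sub_const
      (⌊(M : ℝ) * w₀⌋ : ℝ)).div_const (M : ℝ)
    simpa [hM'] using h
  refine hlin.congr_of_eventuallyEq ?_
  have hcont : ContinuousAt (fun w : ℝ => (M : ℝ) * w) w₀ := by fun_prop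
  have hlow : (⌊(M : ℝ) * w₀⌋ : ℝ) < M * w₀ :=
    lt_of_le_of_ne (Int.floor_le _) fun h => hw ⟨_, h.symm⟩
  filter_upwards [hcont.eventually (Ioo_mem_nhds hlow (Int.lt_floor_add_one _))] with w hw
  have hfloor : ⌊(M : ℝ) * w⌋ = ⌊(M : ℝ) * w₀⌋ := Int.floor_eq_iff.2 ⟨hw.1.le, hw.2⟩
  simp only [gradShape, hfloor]

lemma abs_gradShape_le (M : ℕ) (w : ℝ) : |gradShape M w| ≤ 1 / M := by
  have h₀ : 0 ≤ (M : ℝ) * w - ⌊(M : ℝ) * w⌋ := sub_nonneg.2 (Int.floor_le _)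
  have h₁ : (M : ℝ) * w - ⌊(M : ℝ) * w⌋ ≤ 1 := by
    linarith [Int.lt_floor_add_one ((M : ℝ) * w)]
  rw [gradShape, abs_of_nonneg (by positivity)]
  gcongr

lemma deriv_trainableGate {M : ℕ} (hM : 0 < M) {g : ℝ → ℝ} {w₀ : ℝ}
    (hg : DifferentiableAt ℝ g w₀) (hw₀ : w₀ ≠ 0) (hw : ¬ ∃ k : ℤ, (M : ℝ) * w₀ = k) :
    deriv (trainableGate M stepGate g) w₀ = g w₀ + gradShape M w₀ * deriv g w₀ := by
  have h : HasDerivAt (trainableGate M stepGate g)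
      (0 + (1 * g w₀ + gradShape M w₀ * deriv g w₀)) w₀ :=
    (hasDerivAt_stepGate hw₀).add ((hasDerivAt_gradShape hM hw).mul hg.hasDerivAt)
  rw [h.deriv, zero_add, one_mul]

theorem trainableGate_deriv_approx (g : ℝ → ℝ) (hg : Differentiable ℝ g)
    (C : ℝ) (hgC : ∀ w, |g w| ≤ C) (hg'C : ∀ w, |deriv g w| ≤ C) :
    (∀ M : ℕ, 0 < M → ∀ w₀ : ℝ, w₀ ≠ 0 → (¬ ∃ k : ℤ, (M : ℝ) * w₀ = k) →
      |deriv (trainableGate M stepGate g) w₀ - g w₀| ≤ C / M) ∧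
    (∀ ε : ℝ, 0 < ε → ∃ N : ℕ, ∀ M : ℕ, N ≤ M →
      ∀ w₀ : ℝ, w₀ ≠ 0 → (¬ ∃ k : ℤ, (M : ℝ) * w₀ = k) →
        |deriv (trainableGate M stepGate g) w₀ - g w₀| < ε) := by
  have hbound : ∀ M : ℕ, 0 < M → ∀ w₀ : ℝ, w₀ ≠ 0 → (¬ ∃ k : ℤ, (M : ℝ) * w₀ = k) →
      |deriv (trainableGate M stepGate g) w₀ - g w₀| ≤ C / M := by
    intro M hM w₀ hw₀ hw
    rw [deriv_trainableGate hM (hg w₀) hw₀ hw, add_sub_cancel_left, abs_mul]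
    calc |gradShape M w₀| * |deriv g w₀| ≤ 1 / M * C := by
          gcongr
          exacts [abs_gradShape_le M w₀, hg'C w₀]
      _ = C / M := by ring
  refine ⟨hbound, fun ε hε => ?_⟩
  obtain ⟨N, hN⟩ := Filter.eventually_atTop.1
    (((tendsto_const_div_atTop_nhds_zero_nat C).eventually (gt_mem_nhds hε)).and
      (Filter.eventually_gt_atTop 0))
  exact ⟨N, fun M hM w₀ hw₀ hw =>
    (hbound M (hN M hM).2 w₀ hw₀ hw).trans_lt (hN M hM).1⟩
end
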